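/- Let c > 1/2 and δ > 0 be fixed. Let ℓ ≥ 3 and let ℓ_1, ℓ_2, ℓ_3 be positive integers with ℓ_1+ℓ_2+ℓ_3 = ℓ. Then there exist constants C > 0 and ρ ∈ (0,1), depending only on ℓ, c and δ, such that for all n ≥ 1: V_n^{−2ℓc} ∫_{ℝ^n}∫_{ℝ^n} g_n(x_1)^{ℓ_1} · g_n(x_2)^{ℓ_2} · g_n(x_1+x_2)^{ℓ_3} dx_1 dx_2 ≤ C·ρ^n, where g_n(x) = ( |x|^n + R_n(δ)^n )^{−2c}. -/

import Mathlib

open MeasureTheory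

/-- `V_n = π^{n/2} / Γ(n/2 + 1)`, the volume of the unit ball in `ℝⁿ`. -/
noncomputable def unitBallVol (n : ℕ) : ℝ :=
  Real.pi ^ ((n : ℝ) / 2) / Real.Gamma ((n : ℝ) / 2 + 1)

/-- `R_n(δ) = (δ / V_n)^{1/n}`, the radius of a ball of volume `δ` in `ℝⁿ`. -/
noncomputable def cutRadius (n : ℕ) (δ : ℝ) : ℝ :=
  (δ / unitBallVol n) ^ (1 / (n : ℝ))

/-- `g_n(x) = (|x|^n + R_n(δ)^n)^{-2c}`, the spherical symmetrization of
`|x|^{-2cn}·1_{|x|>R_n(δ)}`. -/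
noncomputable def symTruncPower (n : ℕ) (c δ : ℝ) (x : EuclideanSpace ℝ (Fin n)) : ℝ :=
  (‖x‖ ^ n + cutRadius n δ ^ n) ^ (-(2 * c))


lemma aux_V_pos (n : ℕ) : 0 < unitBallVol n := by
  unfold unitBallVol
  have : 0 < Real.Gamma ((n : ℝ) / 2 + 1) := Real.Gamma_pos_of_pos (by positivity)
  have := Real.pi_pos
  positivity

lemma aux_vol_closedBall (n : ℕ) (hn : 1 ≤ n) (z : EuclideanSpace ℝ (Fin n)) (r : ℝ) (hr : 0 ≤ r) :
    volume (Metric.closedBall z r) = ENNReal.ofReal (unitBallVol n * r ^ n) := by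
  have : Nonempty (Fin n) := ⟨⟨0, hn⟩⟩
  rw [EuclideanSpace.volume_closedBall, Fintype.card_fin, mul_comm, ← ENNReal.ofReal_pow hr,
    ← ENNReal.ofReal_mul (by have := Real.Gamma_pos_of_pos (show 0 < (n : ℝ) / 2 + 1 by positivity)
                             positivity)]
  congr 3
  rw [Real.sqrt_eq_rpow, ← Real.rpow_natCast, ← Real.rpow_mul Real.pi_pos.le]
  congr 1
  ring

/-- rescaled function -/
noncomputable def auxh (n : ℕ) (p δ : ℝ) (x : EuclideanSpace ℝ (Fin n)) : ℝ :=
  (unitBallVol n * ‖x‖ ^ n + δ) ^ (-p)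

lemma aux_sum_pos (n : ℕ) {δ : ℝ} (hδ : 0 < δ) (x : EuclideanSpace ℝ (Fin n)) :
    0 < unitBallVol n * ‖x‖ ^ n + δ := by
  have := aux_V_pos n
  positivity

lemma auxh_nonneg (n : ℕ) (p : ℝ) {δ : ℝ} (hδ : 0 < δ) (x : EuclideanSpace ℝ (Fin n)) :
    0 ≤ auxh n p δ x := Real.rpow_nonneg (aux_sum_pos n hδ x).le _

lemma auxh_le (n : ℕ) (p : ℝ) (hp : 0 < p) {δ : ℝ} (hδ : 0 < δ) (x : EuclideanSpace ℝ (Fin n)) :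
    auxh n p δ x ≤ δ ^ (-p) := by
  unfold auxh
  apply Real.rpow_le_rpow_of_nonpos hδ _ (by linarith)
  have := aux_V_pos n
  have : 0 ≤ unitBallVol n * ‖x‖ ^ n := by positivity
  linarith

lemma auxh_meas (n : ℕ) (p δ : ℝ) : Measurable (auxh n p δ) := by
  unfold auxh
  fun_prop

lemma sym_eq (n : ℕ) (hn : 1 ≤ n) (c δ : ℝ) (hδ : 0 < δ) (x : EuclideanSpace ℝ (Fin n)) :
    symTruncPower n c δ x = unitBallVol n ^ (2 * c) * auxh n (2 * c) δ x := by
  have hV := aux_V_pos n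
  unfold symTruncPower auxh cutRadius
  have h1 : ((δ / unitBallVol n) ^ (1 / (n : ℝ))) ^ n = δ / unitBallVol n := by
    rw [one_div]
    exact Real.rpow_inv_natCast_pow (by positivity) (by omega)
  have h2 : ‖x‖ ^ n + δ / unitBallVol n = (unitBallVol n)⁻¹ * (unitBallVol n * ‖x‖ ^ n + δ) := by
    field_simp
  rw [h1, h2, Real.mul_rpow (by positivity) (aux_sum_pos n hδ x).le, Real.inv_rpow hV.le,
    Real.rpow_neg hV.le, inv_inv]

lemma aux_sublevel (n : ℕ) (hn : 1 ≤ n) (t : ℝ) (ht : 0 ≤ t) :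
    volume {x : EuclideanSpace ℝ (Fin n) | unitBallVol n * ‖x‖ ^ n ≤ t} ≤ ENNReal.ofReal t := by
  have hV := aux_V_pos n
  have h1 : ((t / unitBallVol n) ^ (1 / (n : ℝ))) ^ n = t / unitBallVol n := by
    rw [one_div]
    exact Real.rpow_inv_natCast_pow (by positivity) (by omega)
  have h0 : 0 ≤ (t / unitBallVol n) ^ (1 / (n : ℝ)) := by positivity
  calc _ ≤ volume (Metric.closedBall (0 : EuclideanSpace ℝ (Fin n))
        ((t / unitBallVol n) ^ (1 / (n : ℝ)))) := by
        apply measure_mono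
        intro x hx
        simp only [Set.mem_ofPred_eq] at hx
        rw [mem_closedBall_zero_iff]
        apply le_of_pow_le_pow_left₀ (n := n) (by omega) h0
        rw [h1, le_div_iff₀ hV]
        linarith
    _ = ENNReal.ofReal t := by
        rw [aux_vol_closedBall n hn _ _ h0, h1]
        congr 1
        field_simp

lemma aux_J (p δ : ℝ) (hp : 1 < p) (hδ : 0 < δ) : ∃ B : ENNReal, B ≠ ⊤ ∧ ∀ n : ℕ, 1 ≤ n →
    ∫⁻ x : EuclideanSpace ℝ (Fin n), ENNReal.ofReal (auxh n p δ x) ≤ B := by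
  set D : ℝ := δ ^ (-p) + 2 ^ p with hD
  have hDpos : 0 < D := by positivity
  have hq0 : (0 : ℝ) < 2 ^ (1 - p) := by positivity
  have hq1 : (2 : ℝ) ^ (1 - p) < 1 := Real.rpow_lt_one_of_one_lt_of_neg (by norm_num) (by linarith)
  refine ⟨∑' k : ℕ, ENNReal.ofReal (D * (2 ^ (1 - p)) ^ k), ?_, ?_⟩
  · have hs : Summable (fun k : ℕ => D * ((2 : ℝ) ^ (1 - p)) ^ k) :=
      (summable_geometric_of_lt_one hq0.le hq1).mul_left D
    rw [← ENNReal.ofReal_tsum_of_nonneg (fun k => by positivity) hs]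
    exact ENNReal.ofReal_ne_top
  · intro n hn
    have hV := aux_V_pos n
    let S : ℕ → Set (EuclideanSpace ℝ (Fin n)) := fun k => {x | unitBallVol n * ‖x‖ ^ n ≤ 2 ^ k}
    have hS : ∀ k, MeasurableSet (S k) := fun k =>
      measurableSet_le (by fun_prop) measurable_const
    let F : ℕ → EuclideanSpace ℝ (Fin n) → ENNReal := fun k =>
      (S k).indicator (fun _ => ENNReal.ofReal (D * (2 ^ (-p)) ^ k))
    have hF : ∀ k, Measurable (F k) := fun k => measurable_const.indicator (hS k)
    have hpt : ∀ x, ENNReal.ofReal (auxh n p δ x) ≤ ∑' k, F k x := by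
      intro x
      have hs0 : 0 ≤ unitBallVol n * ‖x‖ ^ n := by positivity
      have key : ∃ k, x ∈ S k ∧ auxh n p δ x ≤ D * (2 ^ (-p)) ^ k := by
        by_cases h1 : unitBallVol n * ‖x‖ ^ n ≤ 1
        · refine ⟨0, by simpa [S] using h1, ?_⟩
          have := auxh_le n p (by linarith) hδ x
          have h2 : (0 : ℝ) < 2 ^ p := by positivity
          simp only [pow_zero, mul_one]
          linarith
        · push Not at h1
          obtain ⟨k, hk1, hk2⟩ := exists_nat_pow_near h1.le (show (1 : ℝ) < 2 by norm_num)
          refine ⟨k + 1, hk2.le, ?_⟩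
          have h3 : auxh n p δ x ≤ ((2 : ℝ) ^ k) ^ (-p) := by
            unfold auxh
            exact Real.rpow_le_rpow_of_nonpos (by positivity) (by linarith) (by linarith)
          have h4 : ((2 : ℝ) ^ k) ^ (-p) = 2 ^ p * (2 ^ (-p)) ^ (k + 1) := by
            rw [pow_succ, mul_comm (((2 : ℝ) ^ (-p)) ^ k), ← mul_assoc,
              ← Real.rpow_add (by norm_num), add_neg_cancel, Real.rpow_zero, one_mul,
              ← Real.rpow_natCast, ← Real.rpow_natCast, ← Real.rpow_mul (by norm_num),
              ← Real.rpow_mul (by norm_num), mul_comm]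
          rw [h4] at h3
          refine h3.trans ?_
          gcongr
          have : 0 < δ ^ (-p) := by positivity
          linarith
      obtain ⟨k, hk, hle⟩ := key
      calc _ ≤ ENNReal.ofReal (D * (2 ^ (-p)) ^ k) := ENNReal.ofReal_le_ofReal hle
        _ = F k x := by simp [F, hk]
        _ ≤ _ := ENNReal.le_tsum k
    calc _ ≤ ∫⁻ x, ∑' k, F k x := lintegral_mono hpt
      _ = ∑' k, ∫⁻ x, F k x := lintegral_tsum (fun k => (hF k).aemeasurable)
      _ ≤ _ := by
        apply ENNReal.tsum_le_tsum
        intro k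
        simp only [F]
        rw [lintegral_indicator (hS k), setLIntegral_const]
        calc _ ≤ ENNReal.ofReal (D * (2 ^ (-p)) ^ k) * ENNReal.ofReal (2 ^ k) := by
              gcongr
              exact aux_sublevel n hn _ (by positivity)
          _ = _ := by
              rw [← ENNReal.ofReal_mul (by positivity)]
              congr 1
              rw [mul_assoc, ← mul_pow]
              congr 2
              rw [sub_eq_add_neg, add_comm, Real.rpow_add (by norm_num), Real.rpow_one]

/-- tail bound -/
lemma aux_T (p δ : ℝ) (hp : 1 < p) (hδ : 0 < δ) : ∃ B : ENNReal, B ≠ ⊤ ∧ ∃ ρ : ℝ, 0 < ρ ∧ ρ < 1 ∧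
    ∀ n : ℕ, 1 ≤ n →
    ∫⁻ x : EuclideanSpace ℝ (Fin n), {x | (21 / 20 : ℝ) ^ n < unitBallVol n * ‖x‖ ^ n}.indicator
      (fun x => ENNReal.ofReal (auxh n p δ x)) x ≤ ENNReal.ofReal (ρ ^ n) * B := by
  obtain ⟨B, hB, h⟩ := aux_J ((p + 1) / 2) δ (by linarith) hδ
  refine ⟨B, hB, (21 / 20 : ℝ) ^ (-((p - 1) / 2)), by positivity,
    Real.rpow_lt_one_of_one_lt_of_neg (by norm_num) (by linarith), ?_⟩
  intro n hn
  refine le_trans ?_ (mul_le_mul_right (h n hn) _)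
  rw [← lintegral_const_mul _ (auxh_meas n _ δ).ennreal_ofReal]
  apply lintegral_mono
  intro x
  by_cases hx : x ∈ {x : EuclideanSpace ℝ (Fin n) | (21 / 20 : ℝ) ^ n < unitBallVol n * ‖x‖ ^ n}
  · simp only [Set.indicator_of_mem hx]
    rw [← ENNReal.ofReal_mul (by positivity)]
    apply ENNReal.ofReal_le_ofReal
    have hpos := aux_sum_pos n hδ x
    have e : auxh n p δ x = (unitBallVol n * ‖x‖ ^ n + δ) ^ (-((p - 1) / 2)) *
        auxh n ((p + 1) / 2) δ x := by
      unfold auxh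
      rw [← Real.rpow_add hpos]
      congr 1
      ring
    rw [e]
    apply mul_le_mul_of_nonneg_right _ (auxh_nonneg n _ hδ x)
    simp only [Set.mem_ofPred_eq] at hx
    calc _ ≤ ((21 / 20 : ℝ) ^ n) ^ (-((p - 1) / 2)) :=
          Real.rpow_le_rpow_of_nonpos (by positivity) (by linarith) (by linarith)
      _ = _ := by
          rw [← Real.rpow_natCast, ← Real.rpow_natCast, ← Real.rpow_mul (by norm_num),
            ← Real.rpow_mul (by norm_num), mul_comm]
  · simp [Set.indicator_of_notMem hx]

/-- geometric part: two balls of radius `21/20 r` with far away centers. -/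
lemma aux_geo (n : ℕ) (hn : 1 ≤ n) (x : EuclideanSpace ℝ (Fin n))
    (hx : (9 / 10 : ℝ) ^ n ≤ unitBallVol n * ‖x‖ ^ n) :
    volume {y : EuclideanSpace ℝ (Fin n) | unitBallVol n * ‖y‖ ^ n ≤ (21 / 20) ^ n ∧
      unitBallVol n * ‖x + y‖ ^ n ≤ (21 / 20) ^ n} ≤ ENNReal.ofReal ((19 / 20) ^ n) := by
  have hV := aux_V_pos n
  set r : ℝ := (1 / unitBallVol n) ^ (1 / (n : ℝ)) with hr
  have hr0 : 0 < r := by positivity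
  have h1 : unitBallVol n * r ^ n = 1 := by
    rw [hr, one_div (n : ℝ), Real.rpow_inv_natCast_pow (by positivity) (by omega)]
    field_simp
  have hle : ∀ (a t : ℝ), 0 ≤ a → 0 ≤ t → unitBallVol n * t ^ n ≤ a ^ n → t ≤ a * r := by
    intro a t ha ht h
    apply le_of_pow_le_pow_left₀ (n := n) (by omega) (by positivity)
    apply le_of_mul_le_mul_left _ hV
    rw [mul_pow, mul_left_comm, h1, mul_one]
    exact h
  have hge : 9 / 10 * r ≤ ‖x‖ := by
    apply le_of_pow_le_pow_left₀ (n := n) (by omega) (by positivity)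
    apply le_of_mul_le_mul_left _ hV
    rw [mul_pow, mul_left_comm, h1, mul_one]
    exact hx
  calc _ ≤ volume (Metric.closedBall (-(1 / 2 : ℝ) • x) (19 / 20 * r)) := by
        apply measure_mono
        rintro y ⟨hy1, hy2⟩
        have hy1 := hle _ _ (by norm_num) (norm_nonneg _) hy1
        have hy2 := hle _ _ (by norm_num) (norm_nonneg _) hy2
        rw [mem_closedBall_iff_norm]
        have hpar := parallelogram_law_with_norm ℝ (y + (1 / 2 : ℝ) • x) ((1 / 2 : ℝ) • x)
        have e1 : y + (1 / 2 : ℝ) • x + (1 / 2 : ℝ) • x = x + y := by module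
        have e2 : y + (1 / 2 : ℝ) • x - (1 / 2 : ℝ) • x = y := by module
        have e3 : y - -(1 / 2 : ℝ) • x = y + (1 / 2 : ℝ) • x := by module
        rw [e1, e2, norm_smul] at hpar
        rw [e3]
        norm_num at hpar
        apply abs_le_of_sq_le_sq' _ (by positivity) |>.2
        have := mul_self_le_mul_self (norm_nonneg _) hy1
        have := mul_self_le_mul_self (norm_nonneg _) hy2
        have := mul_self_le_mul_self (by positivity) hge
        nlinarith [mul_pos hr0 hr0]
    _ = _ := by
        rw [aux_vol_closedBall n hn _ _ (by positivity), mul_pow, mul_left_comm, h1, mul_one]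

lemma aux_main (p δ : ℝ) (hp : 1 < p) (hδ : 0 < δ) : ∃ C ρ : ℝ, 0 < C ∧ 0 < ρ ∧ ρ < 1 ∧
    ∀ n : ℕ, 1 ≤ n →
    ∫⁻ x : EuclideanSpace ℝ (Fin n), ∫⁻ y : EuclideanSpace ℝ (Fin n),
      ENNReal.ofReal (auxh n p δ x) * ENNReal.ofReal (auxh n p δ y) *
        ENNReal.ofReal (auxh n p δ (x + y)) ≤ ENNReal.ofReal (C * ρ ^ n) := by
  obtain ⟨B, hB, hJ⟩ := aux_J p δ hp hδ
  obtain ⟨B', hB', ρ₀, hρ0, hρ1, hT⟩ := aux_T p δ hp hδ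
  set M : ENNReal := ENNReal.ofReal (δ ^ (-p)) with hM
  have hMt : M ≠ ⊤ := ENNReal.ofReal_ne_top
  set A : ENNReal := M * M * B + 3 * (M * B' * B) + M * M * M with hA
  have hAt : A ≠ ⊤ := by finiteness
  set ρ : ℝ := max ρ₀ (399 / 400) with hρ
  have hρpos : 0 < ρ := lt_max_of_lt_left hρ0
  refine ⟨A.toReal + 1, ρ, by positivity, hρpos, max_lt hρ1 (by norm_num), ?_⟩
  intro n hn
  have hV := aux_V_pos n
  set H : EuclideanSpace ℝ (Fin n) → ENNReal := fun x => ENNReal.ofReal (auxh n p δ x) with hH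
  have hHm : Measurable H := (auxh_meas n p δ).ennreal_ofReal
  have hHM : ∀ x, H x ≤ M := fun x => ENNReal.ofReal_le_ofReal (auxh_le n p (by linarith) hδ x)
  let L : Set (EuclideanSpace ℝ (Fin n)) := {x | unitBallVol n * ‖x‖ ^ n ≤ (9 / 10) ^ n}
  let U : Set (EuclideanSpace ℝ (Fin n)) := {x | (21 / 20 : ℝ) ^ n < unitBallVol n * ‖x‖ ^ n}
  have hL : MeasurableSet L := measurableSet_le (by fun_prop) measurable_const
  have hU : MeasurableSet U := measurableSet_lt measurable_const (by fun_prop)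
  let G : EuclideanSpace ℝ (Fin n) → Set (EuclideanSpace ℝ (Fin n)) := fun x =>
    {y | unitBallVol n * ‖y‖ ^ n ≤ (21 / 20) ^ n ∧ unitBallVol n * ‖x + y‖ ^ n ≤ (21 / 20) ^ n}
  have hG : ∀ x, MeasurableSet (G x) := fun x =>
    MeasurableSet.inter
      (measurableSet_le (f := fun y : EuclideanSpace ℝ (Fin n) => unitBallVol n * ‖y‖ ^ n)
        (by fun_prop) measurable_const)
      (measurableSet_le (f := fun y : EuclideanSpace ℝ (Fin n) => unitBallVol n * ‖x + y‖ ^ n)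
        (by fun_prop) measurable_const)
  have hUm : Measurable (U.indicator H) := hHm.indicator hU
  set q : ENNReal := ENNReal.ofReal (ρ ^ n) with hq
  have hTn : ∫⁻ x, U.indicator H x ≤ q * B' := by
    refine (hT n hn).trans ?_
    apply mul_le_mul_left
    apply ENNReal.ofReal_le_ofReal
    exact pow_le_pow_left₀ hρ0.le (le_max_left _ _) n
  have hJn : ∫⁻ x, H x ≤ B := hJ n hn
  have shift : ∀ (f : EuclideanSpace ℝ (Fin n) → ENNReal) x, ∫⁻ y, f (x + y) = ∫⁻ y, f y :=
    fun f x => lintegral_add_left_eq_self f x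
  -- inner bound
  have inner : ∀ x, ∫⁻ y, H x * H y * H (x + y) ≤
      L.indicator (fun _ => M * M * B) x + U.indicator H x * (M * B) + 2 * (H x * (M * (q * B')))
        + {x | unitBallVol n * ‖x‖ ^ n ≤ (21 / 20) ^ n}.indicator
            (fun _ => M * M * M * ENNReal.ofReal ((19 / 20) ^ n)) x := by
    intro x
    have b1 : ∫⁻ y, H x * H y * H (x + y) ≤ H x * (M * B) := by
      calc _ ≤ ∫⁻ y, (H x * M) * H y := by
            apply lintegral_mono
            intro y
            calc H x * H y * H (x + y) ≤ H x * H y * M := by gcongr; exact hHM _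
              _ = _ := by ring
        _ = (H x * M) * ∫⁻ y, H y := lintegral_const_mul _ hHm
        _ ≤ (H x * M) * B := by gcongr
        _ = _ := by ring
    by_cases hxU : x ∈ U
    · rw [Set.indicator_of_mem hxU]
      refine b1.trans ?_
      rw [add_assoc, add_assoc, add_left_comm]
      exact le_self_add
    by_cases hxL : x ∈ L
    · rw [Set.indicator_of_mem hxL]
      refine b1.trans ?_
      rw [add_assoc, add_assoc]
      refine le_trans ?_ le_self_add
      rw [mul_assoc]
      gcongr
      exact hHM _
    have hxU' : unitBallVol n * ‖x‖ ^ n ≤ (21 / 20) ^ n := not_lt.mp hxU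
    have hxL' : (9 / 10) ^ n ≤ unitBallVol n * ‖x‖ ^ n := (not_le.mp hxL).le
    rw [Set.indicator_of_mem (s := {x | unitBallVol n * ‖x‖ ^ n ≤ (21 / 20) ^ n}) hxU']
    have hpt : ∀ y, H x * H y * H (x + y) ≤
        (H x * M) * U.indicator H y + (H x * M) * U.indicator H (x + y) +
          (G x).indicator (fun _ => M * M * M) y := by
      intro y
      by_cases hy : y ∈ U
      · rw [Set.indicator_of_mem hy, add_assoc]
        refine le_trans ?_ le_self_add
        calc H x * H y * H (x + y) ≤ H x * H y * M := by gcongr; exact hHM _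
              _ = _ := by ring
      by_cases hy2 : x + y ∈ U
      · rw [Set.indicator_of_mem hy2, add_assoc, add_left_comm]
        refine le_trans ?_ le_self_add
        calc H x * H y * H (x + y) ≤ H x * M * H (x + y) := by gcongr; exact hHM _
              _ = _ := by ring
      have : y ∈ G x := ⟨not_lt.mp hy, not_lt.mp hy2⟩
      rw [Set.indicator_of_mem this]
      refine le_trans ?_ le_add_self
      gcongr <;> exact hHM _
    have hsm : Measurable (fun y => U.indicator H (x + y)) := hUm.comp (measurable_const_add x)
    calc _ ≤ ∫⁻ y, ((H x * M) * U.indicator H y + (H x * M) * U.indicator H (x + y) +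
          (G x).indicator (fun _ => M * M * M) y) := lintegral_mono hpt
      _ = (H x * M) * (∫⁻ y, U.indicator H y) + (H x * M) * (∫⁻ y, U.indicator H y) +
          M * M * M * volume (G x) := by
        rw [lintegral_add_right _ (measurable_const.indicator (hG x)),
          lintegral_add_right _ (hsm.const_mul _), lintegral_const_mul _ hUm,
          lintegral_const_mul _ hsm, shift, lintegral_indicator (hG x), setLIntegral_const]
      _ ≤ (H x * M) * (q * B') + (H x * M) * (q * B') +
          M * M * M * ENNReal.ofReal ((19 / 20) ^ n) := by
        gcongr
        exact aux_geo n hn x hxL'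
      _ = 2 * (H x * (M * (q * B'))) + M * M * M * ENNReal.ofReal ((19 / 20) ^ n) := by ring
      _ ≤ _ := by
        gcongr
        exact le_add_self
  have hS : MeasurableSet {x : EuclideanSpace ℝ (Fin n) | unitBallVol n * ‖x‖ ^ n ≤ (21 / 20) ^ n} :=
    measurableSet_le (by fun_prop) measurable_const
  calc _ ≤ ∫⁻ x, _ := lintegral_mono inner
    _ = M * M * B * volume L + (∫⁻ x, U.indicator H x) * (M * B) +
        2 * ((∫⁻ x, H x) * (M * (q * B'))) + M * M * M * ENNReal.ofReal ((19 / 20) ^ n) *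
        volume {x : EuclideanSpace ℝ (Fin n) | unitBallVol n * ‖x‖ ^ n ≤ (21 / 20) ^ n} := by
      rw [lintegral_add_right _ (measurable_const.indicator hS),
        lintegral_add_right _ ((hHm.mul_const _).const_mul _),
        lintegral_add_right _ (hUm.mul_const _), lintegral_indicator hL, setLIntegral_const,
        lintegral_indicator hS, setLIntegral_const, lintegral_mul_const _ hUm,
        lintegral_const_mul _ (hHm.mul_const _), lintegral_mul_const _ hHm]
    _ ≤ M * M * B * ENNReal.ofReal ((9 / 10) ^ n) + (q * B') * (M * B) +
        2 * (B * (M * (q * B'))) + M * M * M * ENNReal.ofReal ((19 / 20) ^ n) *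
        ENNReal.ofReal ((21 / 20) ^ n) := by
      gcongr
      · exact aux_sublevel n hn _ (by positivity)
      · exact aux_sublevel n hn _ (by positivity)
    _ = M * M * B * ENNReal.ofReal ((9 / 10) ^ n) + 3 * (M * B' * B) * q +
        M * M * M * ENNReal.ofReal ((399 / 400) ^ n) := by
      have e : ENNReal.ofReal ((399 / 400) ^ n) =
          ENNReal.ofReal ((19 / 20) ^ n) * ENNReal.ofReal ((21 / 20) ^ n) := by
        rw [← ENNReal.ofReal_mul (by positivity), ← mul_pow]
        norm_num
      rw [e]
      ring
    _ ≤ M * M * B * q + 3 * (M * B' * B) * q + M * M * M * q := by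
      have : (9 / 10 : ℝ) ≤ ρ := le_trans (by norm_num) (le_max_right _ _)
      have : (399 / 400 : ℝ) ≤ ρ := le_max_right _ _
      gcongr <;> (apply ENNReal.ofReal_le_ofReal; gcongr)
    _ = A * q := by rw [hA]; ring
    _ = ENNReal.ofReal (A.toReal * ρ ^ n) := by
      rw [ENNReal.ofReal_mul ENNReal.toReal_nonneg, ENNReal.ofReal_toReal hAt]
    _ ≤ _ := by
      apply ENNReal.ofReal_le_ofReal
      gcongr
      linarith

/-- for positive integers `ℓ_1 + ℓ_2 + ℓ_3 = ℓ ≥ 3`, the normalized double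
integral of `g_n(x₁)^{ℓ₁} g_n(x₂)^{ℓ₂} g_n(x₁+x₂)^{ℓ₃}` decays exponentially in `n`. -/
theorem symmetrized_three_fold_integral_bound
    (c δ : ℝ) (hc : 1 / 2 < c) (hδ : 0 < δ)
    (ℓ ℓ₁ ℓ₂ ℓ₃ : ℕ) (hℓ : 3 ≤ ℓ)
    (h₁ : 0 < ℓ₁) (h₂ : 0 < ℓ₂) (h₃ : 0 < ℓ₃)
    (hsum : ℓ₁ + ℓ₂ + ℓ₃ = ℓ) :
    ∃ C ρ : ℝ, 0 < C ∧ ρ ∈ Set.Ioo (0 : ℝ) 1 ∧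
      ∀ n : ℕ, 1 ≤ n →
        unitBallVol n ^ (-(2 * (ℓ : ℝ) * c)) *
          ∫ x₁ : EuclideanSpace ℝ (Fin n), ∫ x₂ : EuclideanSpace ℝ (Fin n),
            symTruncPower n c δ x₁ ^ ℓ₁ * symTruncPower n c δ x₂ ^ ℓ₂ *
              symTruncPower n c δ (x₁ + x₂) ^ ℓ₃
        ≤ C * ρ ^ n := by
  obtain ⟨C, ρ, hC, hρ0, hρ1, hmain⟩ := aux_main (2 * c) δ (by linarith) hδ
  set m : ℝ := δ ^ (-(2 * c)) with hm
  have hm0 : 0 < m := by positivity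
  set K : ℝ := m ^ (ℓ₁ - 1) * m ^ (ℓ₂ - 1) * m ^ (ℓ₃ - 1) with hK
  have hK0 : 0 < K := by positivity
  refine ⟨K * C, ρ, by positivity, ⟨hρ0, hρ1⟩, ?_⟩
  intro n hn
  have hV := aux_V_pos n
  set h : EuclideanSpace ℝ (Fin n) → ℝ := auxh n (2 * c) δ with hh
  have hn0 : ∀ x, 0 ≤ h x := auxh_nonneg n _ hδ
  have hpow : ∀ (k : ℕ) (_ : 0 < k) x, h x ^ k ≤ m ^ (k - 1) * h x := by
    intro k hk x
    obtain ⟨j, rfl⟩ : ∃ j, k = j + 1 := ⟨k - 1, by omega⟩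
    rw [pow_succ, Nat.add_sub_cancel]
    have := auxh_le n (2 * c) (by linarith) hδ x
    have := hn0 x
    gcongr
  have hint : ∀ x y : EuclideanSpace ℝ (Fin n),
      symTruncPower n c δ x ^ ℓ₁ * symTruncPower n c δ y ^ ℓ₂ * symTruncPower n c δ (x + y) ^ ℓ₃
      = unitBallVol n ^ (2 * (ℓ : ℝ) * c) * (h x ^ ℓ₁ * h y ^ ℓ₂ * h (x + y) ^ ℓ₃) := by
    intro x y
    rw [sym_eq n hn c δ hδ, sym_eq n hn c δ hδ, sym_eq n hn c δ hδ]
    have : unitBallVol n ^ (2 * (ℓ : ℝ) * c) = (unitBallVol n ^ (2 * c)) ^ ℓ := by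
      rw [← Real.rpow_natCast, ← Real.rpow_mul hV.le]
      congr 1
      ring
    rw [this, ← hsum]
    ring
  simp_rw [hint, integral_const_mul]
  rw [← mul_assoc, ← Real.rpow_add hV, neg_add_cancel, Real.rpow_zero, one_mul]
  have hCρ : 0 ≤ K * C * ρ ^ n := by positivity
  refine (le_abs_self _).trans ?_
  rw [← Real.norm_eq_abs, ← toReal_enorm]
  apply ENNReal.toReal_le_of_le_ofReal hCρ
  calc _ ≤ ∫⁻ x, ‖∫ y, h x ^ ℓ₁ * h y ^ ℓ₂ * h (x + y) ^ ℓ₃‖ₑ := enorm_integral_le_lintegral_enorm _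
    _ ≤ ∫⁻ x, ∫⁻ y, ‖h x ^ ℓ₁ * h y ^ ℓ₂ * h (x + y) ^ ℓ₃‖ₑ :=
      lintegral_mono fun x => enorm_integral_le_lintegral_enorm _
    _ ≤ ∫⁻ x, ∫⁻ y, ENNReal.ofReal K * (ENNReal.ofReal (h x) * ENNReal.ofReal (h y) *
        ENNReal.ofReal (h (x + y))) := by
      apply lintegral_mono
      intro x
      apply lintegral_mono
      intro y
      have a1 := hn0 x
      have a2 := hn0 y
      have a3 := hn0 (x + y)
      simp only
      rw [Real.enorm_of_nonneg (by positivity), ← ENNReal.ofReal_mul a1,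
        ← ENNReal.ofReal_mul (by positivity), ← ENNReal.ofReal_mul hK0.le]
      apply ENNReal.ofReal_le_ofReal
      calc _ ≤ (m ^ (ℓ₁ - 1) * h x) * (m ^ (ℓ₂ - 1) * h y) * (m ^ (ℓ₃ - 1) * h (x + y)) := by
            gcongr
            · exact hpow _ h₁ _
            · exact hpow _ h₂ _
            · exact hpow _ h₃ _
        _ = _ := by rw [hK]; ring
    _ = ENNReal.ofReal K * ∫⁻ x, ∫⁻ y, (ENNReal.ofReal (h x) * ENNReal.ofReal (h y) *
        ENNReal.ofReal (h (x + y))) := by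
      simp_rw [lintegral_const_mul' _ _ ENNReal.ofReal_ne_top]
    _ ≤ ENNReal.ofReal K * ENNReal.ofReal (C * ρ ^ n) := by
      gcongr
      exact hmain n hn
    _ = _ := by
      rw [← ENNReal.ofReal_mul hK0.le, mul_assoc K]
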